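/- Let X ⊂ ℝ² be a strongly convex body with smooth boundary. Through any point z ∈ ∂X there is at most one 4-periodic outer billiard trajectory, i.e., at most one quadrilateral circumscribed about X with all sides tangent to ∂X at their midpoints and one tangency point equal to z. -/

import Mathlib

open scoped RealInnerProductSpace

/-- `z` is the tangency point of the side `[p, q]` of a circumscribed polygon:
`z` is the midpoint of `p` and `q`, and the line through `p` and `q` touches the
body `X` exactly at `z`. -/
def SideTangentAtMidpoint (X : Set (EuclideanSpace ℝ (Fin 2)))
    (p q : EuclideanSpace ℝ (Fin 2)) : Prop :=
  midpoint ℝ p q ∈ frontier X ∧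
    (affineSpan ℝ {p, q} : Set (EuclideanSpace ℝ (Fin 2))) ∩ X = {midpoint ℝ p q}

/-- A 4-periodic outer billiard trajectory: a quadrilateral circumscribed about `X` whose
sides are tangent to `∂X` exactly at their midpoints. -/
def IsOuterTraj4 (X : Set (EuclideanSpace ℝ (Fin 2)))
    (x : Fin 4 → EuclideanSpace ℝ (Fin 2)) : Prop :=
  Function.Injective x ∧ ∀ i : Fin 4, SideTangentAtMidpoint X (x i) (x (i + 1))

abbrev OB.E2 := EuclideanSpace ℝ (Fin 2)

namespace OB

/-- The scalar core: `z1'` cannot lie past `z2`. -/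
theorem caseB (b c k a1 b1 a3 b3 : ℝ) (hb : 0 < b) (hb1 : b < 1) (hc : 0 < c) (hc1 : c < 1)
    (hk : 1 < k)
    (q1 : 0 < b * a1 + c * b1) (q3 : 0 < b * a3 + c * b3)
    (s1 : 0 < b * (1 - a1) + (1 - c) * b1)
    (s1' : 0 < -b1 + k * (b * a1 + c * b1 - b))
    (s3 : 0 < c * (1 - b3) + (1 - b) * a3)
    (s3' : 0 < -a3 + k * (b * a3 + c * b3 - c))
    (h13 : 0 ≤ b * (1 - a3) + (1 - c) * b3)
    (h22 : 0 ≤ (1 - c) * (1 - (b1 + b3)) + (1 - b) * (1 - (a1 + a3)))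
    (h32 : 0 ≤ c * (1 - (b1 + b3)) + (1 - b) * (a1 + a3))
    (p3 : 0 ≤ a1 + k * (b * a1 + c * b1 - c))
    (p2 : 0 ≤ a1 - b1 + k * (b * a1 + c * b1 - b - c))
    (r1 : 0 ≤ b3 + k * (b * a3 + c * b3 - b))
    (r2 : 0 ≤ b3 - a3 + k * (b * a3 + c * b3 - b - c))
    (det : 0 < a1 * b3 - b1 * a3)
    (B : (1 - c) ≤ (1 - c) * (1 - b1) + (1 - b) * (1 - a1)) : False := by
  have g1 : 0 < b * a1 + c * b1 - b := by
    by_contra h; push Not at h; nlinarith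
  have g3 : 0 < b * a3 + c * b3 - c := by
    by_contra h; push Not at h; nlinarith
  have hb1p : 0 < b1 := by nlinarith
  have ha3p : 0 < a3 := by nlinarith
  have ha1 : a1 < 1 := by
    by_contra h; push Not at h
    nlinarith [mul_pos (sub_pos.2 hc1) hb1p, mul_nonneg (sub_pos.2 hb1).le (sub_nonneg.2 h)]
  have hbc : b < c := by
    have e1 : b * ((1 - c) * b1) ≤ b * ((1 - b) * (1 - a1)) :=
      mul_le_mul_of_nonneg_left (by linarith) hb.le
    have e2 : (1 - b) * (b * (1 - a1)) < (1 - b) * (c * b1) :=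
      mul_lt_mul_of_pos_left (by linarith) (by linarith)
    have e3 : 0 < (c - b) * b1 := by nlinarith
    by_contra h; push Not at h; nlinarith
  have c1 : 1 ≤ b1 := by
    by_contra h; push Not at h
    rcases lt_or_ge a1 0 with h0 | h0
    · have : b * a1 + c * b1 - c < 0 := by nlinarith
      nlinarith
    · have t0 := mul_pos (mul_pos (sub_pos.2 ha1) (sub_pos.2 h)) (mul_pos (by linarith : 0 < k) q1)
      have t1 := mul_nonneg (mul_nonneg h0 (sub_pos.2 h).le) s1'.le
      have t2 := mul_nonneg (mul_nonneg (sub_pos.2 ha1).le hb1p.le) p3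
      have t3 := mul_nonneg (mul_nonneg h0 hb1p.le) p2
      linarith
  have c3 : 1 ≤ b3 := by
    by_contra h; push Not at h
    by_cases hin : 0 ≤ b3 ∧ a3 ≤ 1
    · obtain ⟨i1, i2⟩ := hin
      have t0 := mul_nonneg (mul_nonneg (sub_nonneg.2 i2) (sub_pos.2 h).le)
        (mul_pos (by linarith : 0 < k) q3).le
      have t1 := mul_nonneg (mul_nonneg ha3p.le (sub_pos.2 h).le) r1
      have t2 := mul_nonneg (mul_nonneg (sub_nonneg.2 i2) i1) s3'.le
      have t3 := mul_nonneg (mul_nonneg ha3p.le i1) r2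
      have t1s : 0 < b3 + k * (b * a3 + c * b3 - b) := by
        have u1 : 0 < b * a3 + c * b3 - b := by linarith
        have u2 := mul_pos (by linarith : 0 < k) u1
        linarith
      have t1' := mul_pos (mul_pos ha3p (sub_pos.2 h)) t1s
      linarith
    · have ha : 1 < a3 := by
        by_contra h'; push Not at h'
        have : b3 < 0 := by
          by_contra h''; push Not at h''; exact hin ⟨h'', h'⟩
        have u1 := mul_pos hc (neg_pos.2 this)
        have u2 := mul_nonneg hb.le (sub_nonneg.2 h')
        linarith
      have hb3 : 0 < b3 := by
        by_contra h'; push Not at h'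
        have u1 := mul_nonneg (sub_pos.2 hc1).le (neg_nonneg.2 h')
        have u2 := mul_pos hb (sub_pos.2 ha)
        linarith
      have u3 := mul_nonneg (sub_nonneg.2 c1) ha3p.le
      have u4 := mul_pos (sub_pos.2 ha1) hb3
      linarith
  linarith

theorem scalar (b c k a1 b1 a3 b3 : ℝ) (hb : 0 < b) (hb1 : b < 1) (hc : 0 < c) (hc1 : c < 1)
    (hk : 1 < k)
    (q1 : 0 < b * a1 + c * b1) (q3 : 0 < b * a3 + c * b3)
    (s1 : 0 < b * (1 - a1) + (1 - c) * b1)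
    (s1' : 0 < -b1 + k * (b * a1 + c * b1 - b))
    (s3 : 0 < c * (1 - b3) + (1 - b) * a3)
    (s3' : 0 < -a3 + k * (b * a3 + c * b3 - c))
    (h13 : 0 ≤ b * (1 - a3) + (1 - c) * b3)
    (h31 : 0 ≤ c * (1 - b1) + (1 - b) * a1)
    (h22 : 0 ≤ (1 - c) * (1 - (b1 + b3)) + (1 - b) * (1 - (a1 + a3)))
    (h32 : 0 ≤ c * (1 - (b1 + b3)) + (1 - b) * (a1 + a3))
    (h12 : 0 ≤ b * (1 - (a1 + a3)) + (1 - c) * (b1 + b3))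
    (p3 : 0 ≤ a1 + k * (b * a1 + c * b1 - c))
    (p2 : 0 ≤ a1 - b1 + k * (b * a1 + c * b1 - b - c))
    (r1 : 0 ≤ b3 + k * (b * a3 + c * b3 - b))
    (r2 : 0 ≤ b3 - a3 + k * (b * a3 + c * b3 - b - c))
    (det : 0 < a1 * b3 - b1 * a3) : False := by
  by_cases B : (1 - c) ≤ (1 - c) * (1 - b1) + (1 - b) * (1 - a1)
  · exact caseB b c k a1 b1 a3 b3 hb hb1 hc hc1 hk q1 q3 s1 s1' s3 s3' h13 h22 h32 p3 p2 r1 r2 det B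
  by_cases B' : (1 - b) ≤ (1 - b) * (1 - a3) + (1 - c) * (1 - b3)
  · refine caseB c b k b3 a3 b1 a1 hc hc1 hb hb1 hk ?_ ?_ ?_ ?_ ?_ ?_ ?_ ?_ ?_ ?_ ?_ ?_ ?_ ?_ ?_ <;>
      linarith
  · linarith

/-- planar determinant -/
def D (u v : E2) : ℝ := u 0 * v 1 - u 1 * v 0

/-- A positively oriented trajectory relative to the tangency point `z`, with vertices
`z - e, z + e, z + 2 w1 - e, z + 2 w3 + e`. -/
structure PosT (X : Set E2) (z e w1 w3 : E2) : Prop where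
  m0 : z ∈ X
  m1 : z + w1 ∈ X
  m2 : z + (w1 + w3) ∈ X
  m3 : z + w3 ∈ X
  n1 : w1 ≠ 0
  n3 : w3 ≠ 0
  f0 : ∀ y, z + y ∈ X → 0 ≤ D e y
  f1 : ∀ y, z + y ∈ X → 0 ≤ D (w1 - e) (y - e)
  f2 : ∀ y, z + y ∈ X → 0 ≤ D (w3 - w1 + e) (y - (w1 + w3))
  f3 : ∀ y, z + y ∈ X → 0 ≤ D (-e - w3) (y + e)
  g0 : ∀ y, z + y ∈ X → D e y = 0 → y = 0
  g1 : ∀ y, z + y ∈ X → D (w1 - e) (y - e) = 0 → y = w1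
  g2 : ∀ y, z + y ∈ X → D (w3 - w1 + e) (y - (w1 + w3)) = 0 → y = w1 + w3
  g3 : ∀ y, z + y ∈ X → D (-e - w3) (y + e) = 0 → y = w3

theorem coords (w1 w3 v : E2) (h : D w1 w3 ≠ 0) : ∃ a b : ℝ, v = a • w1 + b • w3 := by
  refine ⟨D v w3 / D w1 w3, D w1 v / D w1 w3, ?_⟩
  ext i
  fin_cases i <;> simp <;> field_simp <;> simp only [D] <;> ring

theorem lin (X : Set E2) (z e w1 w3 v1 v3 : E2) (k : ℝ) (hk : 1 < k)
    (T : PosT X z e w1 w3) (T' : PosT X z (k • e) v1 v3) (hv1 : v1 ≠ w1) (hv3 : v3 ≠ w3) :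
    False := by
  have m0 : z + 0 ∈ X := by simpa using T.m0
  have e1 : 0 < D e w1 := lt_of_le_of_ne (T.f0 _ T.m1) (fun h => T.n1 (T.g0 _ T.m1 h.symm))
  have e3 : 0 < D e w3 := lt_of_le_of_ne (T.f0 _ T.m3) (fun h => T.n3 (T.g0 _ T.m3 h.symm))
  have x1 : 0 < D e v1 := lt_of_le_of_ne (T.f0 _ T'.m1) (fun h => T'.n1 (T.g0 _ T'.m1 h.symm))
  have x3 : 0 < D e v3 := lt_of_le_of_ne (T.f0 _ T'.m3) (fun h => T'.n3 (T.g0 _ T'.m3 h.symm))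
  have k1 : 0 < D (w1 - e) (w1 + w3 - e) := lt_of_le_of_ne (T.f1 _ T.m2)
    (fun h => T.n3 (by simpa using T.g1 _ T.m2 h.symm))
  have k3 : 0 < D (-e - w3) (w1 + w3 + e) := lt_of_le_of_ne (T.f3 _ T.m2)
    (fun h => T.n1 (by simpa using T.g3 _ T.m2 h.symm))
  have hC : 0 < D w1 w3 := by
    simp only [D, PiLp.sub_apply, PiLp.add_apply] at *
    nlinarith
  have s1 : 0 < D (w1 - e) (v1 - e) := lt_of_le_of_ne (T.f1 _ T'.m1)
    (fun h => hv1 (T.g1 _ T'.m1 h.symm))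
  have s3 : 0 < D (-e - w3) (v3 + e) := lt_of_le_of_ne (T.f3 _ T'.m3)
    (fun h => hv3 (T.g3 _ T'.m3 h.symm))
  have s1' : 0 < D (v1 - k • e) (w1 - k • e) := lt_of_le_of_ne (T'.f1 _ T.m1)
    (fun h => hv1 (T'.g1 _ T.m1 h.symm).symm)
  have s3' : 0 < D (-(k • e) - v3) (w3 + k • e) := lt_of_le_of_ne (T'.f3 _ T.m3)
    (fun h => hv3 (T'.g3 _ T.m3 h.symm).symm)
  have h13 := T.f1 _ T'.m3
  have h31 := T.f3 _ T'.m1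
  have h22 := T.f2 _ T'.m2
  have h32 := T.f3 _ T'.m2
  have h12 := T.f1 _ T'.m2
  have p3 := T'.f1 _ T.m3
  have p2 := T'.f1 _ T.m2
  have r1 := T'.f3 _ T.m1
  have r2 := T'.f3 _ T.m2
  have dt := T'.f1 _ T'.m2
  obtain ⟨a1, b1, rfl⟩ := coords w1 w3 v1 hC.ne'
  obtain ⟨a3, b3, rfl⟩ := coords w1 w3 v3 hC.ne'
  obtain ⟨c, b', rfl⟩ := coords w1 w3 e hC.ne'
  obtain ⟨b, rfl⟩ : ∃ b, b' = -b := ⟨-b', by simp⟩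
  clear T T' m0 hv1 hv3
  have P : ∀ t : ℝ, 0 < D w1 w3 * t → 0 < t := fun t h => pos_of_mul_pos_right h hC.le
  have N : ∀ t : ℝ, 0 ≤ D w1 w3 * t → 0 ≤ t := fun t h => nonneg_of_mul_nonneg_right h hC
  have hb : 0 < b := P _ (by convert e1 using 1; simp [D]; ring)
  have hc : 0 < c := P _ (by convert e3 using 1; simp [D]; ring)
  have q3 : 0 < b * a3 + c * b3 := P _ (by convert x3 using 1; simp [D]; ring)
  have dt' : 0 ≤ a1 * b3 - b1 * a3 - k * (b * a3 + c * b3) :=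
    N _ (by convert dt using 1; simp [D]; ring)
  refine scalar b c k a1 b1 a3 b3 hb (sub_pos.1 (P _ ?_)) hc (sub_pos.1 (P _ ?_)) hk (P _ ?_) q3 (P _ ?_)
    (P _ ?_) (P _ ?_) (P _ ?_) (N _ ?_) (N _ ?_) (N _ ?_) (N _ ?_) (N _ ?_) (N _ ?_) (N _ ?_)
    (N _ ?_) (N _ ?_) ?_
  · convert k3 using 1; simp [D]; ring
  · convert k1 using 1; simp [D]; ring
  · convert x1 using 1; simp [D]; ring
  · convert s1 using 1; simp [D]; ring
  · convert s1' using 1; simp [D]; ring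
  · convert s3 using 1; simp [D]; ring
  · convert s3' using 1; simp [D]; ring
  · convert h13 using 1; simp [D]; ring
  · convert h31 using 1; simp [D]; ring
  · convert h22 using 1; simp [D]; ring
  · convert h32 using 1; simp [D]; ring
  · convert h12 using 1; simp [D]; ring
  · convert p3 using 1; simp [D]; ring
  · convert p2 using 1; simp [D]; ring
  · convert r1 using 1; simp [D]; ring
  · convert r2 using 1; simp [D]; ring
  · have := mul_pos (by linarith : 0 < k) q3
    linarith

theorem D_par (u v : E2) (hu : u ≠ 0) (h : D u v = 0) : ∃ t : ℝ, v = t • u := by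
  have h' : u 0 * v 1 = u 1 * v 0 := by simpa [D, sub_eq_zero] using h
  by_cases h0 : u 0 = 0
  · have h1 : u 1 ≠ 0 := by
      intro h1; apply hu; ext i; fin_cases i <;> simp [h0, h1]
    refine ⟨v 1 / u 1, ?_⟩
    have : v 0 = 0 := by
      rw [h0, zero_mul] at h'
      exact (mul_eq_zero.1 h'.symm).resolve_left h1
    ext i; fin_cases i <;> simp [this, h0, h1]
  · refine ⟨v 0 / u 0, ?_⟩
    ext i; fin_cases i <;> simp <;> field_simp
    linarith

/-- positively oriented side -/
structure Side (X : Set E2) (p q : E2) : Prop where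
  m : midpoint ℝ p q ∈ frontier X
  f : ∀ y ∈ X, 0 ≤ D (q - p) (y - p)
  g : ∀ y ∈ X, D (q - p) (y - p) = 0 → y = midpoint ℝ p q

theorem side_or (X : Set E2) (hc : Convex ℝ X) (hi : (interior X).Nonempty) (p q : E2)
    (hpq : p ≠ q) (h : SideTangentAtMidpoint X p q) : Side X p q ∨ Side X q p := by
  obtain ⟨hm, hl⟩ := h
  have hd : q - p ≠ 0 := sub_ne_zero.2 hpq.symm
  have g : ∀ y ∈ X, D (q - p) (y - p) = 0 → y = midpoint ℝ p q := by
    intro y hy h0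
    obtain ⟨t, ht⟩ := D_par _ _ hd h0
    have : y ∈ (affineSpan ℝ {p, q} : Set E2) ∩ X := by
      refine ⟨?_, hy⟩
      have : y = AffineMap.lineMap p q t := by
        rw [AffineMap.lineMap_apply, vsub_eq_sub, vadd_eq_add, ← ht]; simp
      rw [this]
      exact AffineMap.lineMap_mem_affineSpan_pair t p q
    rw [hl] at this
    exact this
  have hint : ∀ o ∈ interior X, D (q - p) (o - p) ≠ 0 := by
    intro o ho h0
    have e1 := g o (interior_subset ho) h0
    have hcont : Filter.Tendsto (fun t : ℝ => o + t • (q - p)) (nhdsWithin 0 {0}ᶜ) (nhds o) := by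
      have : Continuous (fun t : ℝ => o + t • (q - p)) := by fun_prop
      have := this.tendsto 0
      simp only [zero_smul, add_zero] at this
      exact this.mono_left nhdsWithin_le_nhds
    have hev := hcont.eventually (mem_interior_iff_mem_nhds.1 ho)
    obtain ⟨t, ht, ht0⟩ := (hev.and self_mem_nhdsWithin).exists
    have e2 := g _ ht (by
      have : D (q - p) (o + t • (q - p) - p) = D (q - p) (o - p) := by
        simp [D]; ring
      rw [this, h0])
    rw [← e1] at e2
    have : t • (q - p) = 0 := by simpa using e2
    rcases smul_eq_zero.1 this with h | h
    · exact ht0 h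
    · exact hd h
  obtain ⟨o, ho⟩ := hi
  have key : ∀ y ∈ X, ∀ a b : ℝ, 0 < a → 0 < b → a + b = 1 →
      a * D (q - p) (o - p) + b * D (q - p) (y - p) ≠ 0 := by
    intro y hy a b ha hb hab h0
    refine hint (a • o + b • y)
      (hc.openSegment_interior_self_subset_interior ho hy ⟨a, b, ha, hb, hab, rfl⟩) ?_
    rw [← h0]
    obtain rfl : a = 1 - b := by linarith
    simp [D]; ring
  have mid : midpoint ℝ q p = midpoint ℝ p q := midpoint_comm _ _
  have Dsw : ∀ y, D (p - q) (y - q) = - D (q - p) (y - p) := by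
    intro y; simp [D]; ring
  rcases lt_or_gt_of_ne (hint o ho) with h | h
  · right
    refine ⟨mid ▸ hm, ?_, ?_⟩
    · intro y hy
      rw [Dsw]
      by_contra hcon
      push Not at hcon
      have hpos : 0 < D (q - p) (y - p) - D (q - p) (o - p) := by linarith
      refine key y hy (D (q - p) (y - p) / (D (q - p) (y - p) - D (q - p) (o - p)))
        (- D (q - p) (o - p) / (D (q - p) (y - p) - D (q - p) (o - p)))
        (div_pos (by linarith) hpos) (div_pos (by linarith) hpos) (by field_simp; ring)
        (by field_simp; ring)
    · intro y hy h0
      rw [Dsw] at h0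
      rw [mid]; exact g y hy (by linarith)
  · left
    refine ⟨hm, ?_, g⟩
    intro y hy
    by_contra hcon
    push Not at hcon
    have hpos : 0 < D (q - p) (o - p) - D (q - p) (y - p) := by linarith
    refine key y hy (-D (q - p) (y - p) / (D (q - p) (o - p) - D (q - p) (y - p)))
      (D (q - p) (o - p) / (D (q - p) (o - p) - D (q - p) (y - p)))
      (div_pos (by linarith) hpos) (div_pos (by linarith) hpos) (by field_simp; ring)
      (by field_simp; ring)

theorem mid_apply (p q : E2) (i : Fin 2) : (midpoint ℝ p q) i = (p i + q i) / 2 := by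
  simp [midpoint_eq_smul_add]; ring

theorem mid_inj (p q r : E2) (h : midpoint ℝ p q = midpoint ℝ q r) : p = r := by
  ext i
  have := congrArg (fun v : E2 => v i) h
  simp only [mid_apply] at this
  linarith

theorem side_cons (X : Set E2) (hX : IsClosed X) (p q r : E2) (h1 : Side X p q) (h2 : Side X r q) :
    p = r := by
  have a := h1.f _ (hX.frontier_subset h2.m)
  have b := h2.f _ (hX.frontier_subset h1.m)
  have e : D (q - p) (midpoint ℝ r q - p) = - D (q - r) (midpoint ℝ p q - r) := by
    simp [D, mid_apply]; ring
  have := h1.g _ (hX.frontier_subset h2.m) (by linarith)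
  rw [midpoint_comm r q] at this
  exact mid_inj _ _ _ this.symm

theorem side_cons' (X : Set E2) (hX : IsClosed X) (p q r : E2) (h1 : Side X q p)
    (h2 : Side X q r) : p = r := by
  have a := h1.f _ (hX.frontier_subset h2.m)
  have b := h2.f _ (hX.frontier_subset h1.m)
  have e : D (p - q) (midpoint ℝ q r - q) = - D (r - q) (midpoint ℝ q p - q) := by
    simp [D, mid_apply]; ring
  have := h1.g _ (hX.frontier_subset h2.m) (by linarith)
  rw [midpoint_comm q p] at this
  exact mid_inj _ _ _ this.symm

/-- positively oriented quadrilateral -/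
structure Quad (X : Set E2) (a b c d : E2) : Prop where
  ab : Side X a b
  bc : Side X b c
  cd : Side X c d
  da : Side X d a
  n1 : a ≠ b
  n2 : a ≠ c
  n3 : b ≠ d

theorem norm_traj (X : Set E2) (hc : Convex ℝ X) (hX : IsClosed X) (hi : (interior X).Nonempty)
    (x : Fin 4 → E2) (hx : IsOuterTraj4 X x) :
    ∃ a b c d, Quad X a b c d ∧ midpoint ℝ a b = midpoint ℝ (x 0) (x 1) ∧
      Set.range x = {a, b, c, d} := by
  obtain ⟨inj, hs⟩ := hx
  have n01 : x 0 ≠ x 1 := inj.ne (by decide)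
  have n12 : x 1 ≠ x 2 := inj.ne (by decide)
  have n23 : x 2 ≠ x 3 := inj.ne (by decide)
  have n30 : x 3 ≠ x 0 := inj.ne (by decide)
  have n02 : x 0 ≠ x 2 := inj.ne (by decide)
  have n13 : x 1 ≠ x 3 := inj.ne (by decide)
  have s0 := side_or X hc hi _ _ n01 (hs 0)
  have s1 := side_or X hc hi _ _ n12 (hs 1)
  have s2 := side_or X hc hi _ _ n23 (hs 2)
  have s3 := side_or X hc hi _ _ n30 (hs 3)
  have hr : Set.range x = {x 0, x 1, x 2, x 3} := by
    ext y
    simp [Fin.exists_fin_succ, eq_comm]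
  rcases s0 with s0 | s0
  · have s1 := s1.resolve_right (fun h => n02 (side_cons X hX _ _ _ s0 h))
    have s2 := s2.resolve_right (fun h => n13 (side_cons X hX _ _ _ s1 h))
    have s3 := s3.resolve_right (fun h => n02.symm (side_cons X hX _ _ _ s2 h))
    exact ⟨x 0, x 1, x 2, x 3, ⟨s0, s1, s2, s3, n01, n02, n13⟩, rfl, hr⟩
  · have s1 := s1.resolve_left (fun h => n02 (side_cons' X hX _ _ _ s0 h))
    have s2 := s2.resolve_left (fun h => n13 (side_cons' X hX _ _ _ s1 h))
    have s3 := s3.resolve_left (fun h => n02.symm (side_cons' X hX _ _ _ s2 h))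
    refine ⟨x 1, x 0, x 3, x 2, ⟨s0, s3, s2, s1, n01.symm, n13, n02⟩, midpoint_comm _ _, ?_⟩
    rw [hr]
    ext y
    simp only [Set.mem_insert_iff, Set.mem_singleton_iff]
    tauto

theorem quad_posT (X : Set E2) (hX : IsClosed X) (a b c d z e w1 w3 : E2) (Q : Quad X a b c d)
    (hz : z = midpoint ℝ a b) (he : b = z + e)
    (hw1 : z + w1 = midpoint ℝ b c) (hw3 : z + w3 = midpoint ℝ d a) :
    PosT X z e w1 w3 := by
  have hE : ∀ i, a i = z i - e i ∧ b i = z i + e i ∧ c i = z i + 2 * w1 i - e i ∧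
      d i = z i + 2 * w3 i + e i := by
    intro i
    have h1 := congrArg (fun v : E2 => v i) hz
    have h2 := congrArg (fun v : E2 => v i) he
    have h3 := congrArg (fun v : E2 => v i) hw1
    have h4 := congrArg (fun v : E2 => v i) hw3
    simp only [mid_apply, PiLp.add_apply] at h1 h2 h3 h4
    refine ⟨?_, ?_, ?_, ?_⟩ <;> linarith
  have hw2 : z + (w1 + w3) = midpoint ℝ c d := by
    ext i
    obtain ⟨h1, h2, h3, h4⟩ := hE i
    simp only [mid_apply, PiLp.add_apply, h3, h4]
    ring
  obtain ⟨a0, b0, c0, d0⟩ := hE 0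
  obtain ⟨a1, b1, c1, d1⟩ := hE 1
  have d0' : ∀ y, D (b - a) (z + y - a) = 2 * D e y := by
    intro y; simp [D, a0, b0, a1, b1]; ring
  have d1' : ∀ y, D (c - b) (z + y - b) = 2 * D (w1 - e) (y - e) := by
    intro y; simp [D, c0, b0, c1, b1]; ring
  have d2' : ∀ y, D (d - c) (z + y - c) = 2 * D (w3 - w1 + e) (y - (w1 + w3)) := by
    intro y; simp [D, c0, d0, c1, d1]; ring
  have d3' : ∀ y, D (a - d) (z + y - d) = 2 * D (-e - w3) (y + e) := by
    intro y; simp [D, a0, d0, a1, d1]; ring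
  refine ⟨?_, ?_, ?_, ?_, ?_, ?_, ?_, ?_, ?_, ?_, ?_, ?_, ?_, ?_⟩
  · rw [hz]; exact hX.frontier_subset Q.ab.m
  · rw [hw1]; exact hX.frontier_subset Q.bc.m
  · rw [hw2]; exact hX.frontier_subset Q.cd.m
  · rw [hw3]; exact hX.frontier_subset Q.da.m
  · rintro rfl
    rw [add_zero, hz] at hw1
    exact Q.n2 (mid_inj _ _ _ hw1)
  · rintro rfl
    rw [add_zero, hz] at hw3
    exact Q.n3 (mid_inj _ _ _ hw3.symm).symm
  · intro y hy
    have := Q.ab.f _ hy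
    rw [d0'] at this; linarith
  · intro y hy
    have := Q.bc.f _ hy
    rw [d1'] at this; linarith
  · intro y hy
    have := Q.cd.f _ hy
    rw [d2'] at this; linarith
  · intro y hy
    have := Q.da.f _ hy
    rw [d3'] at this; linarith
  · intro y hy h0
    have := Q.ab.g _ hy (by rw [d0', h0]; simp)
    rw [← hz] at this; simpa using this
  · intro y hy h0
    have := Q.bc.g _ hy (by rw [d1', h0]; simp)
    rw [← hw1] at this; simpa using this
  · intro y hy h0
    have := Q.cd.g _ hy (by rw [d2', h0]; simp)
    rw [← hw2] at this; simpa using this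
  · intro y hy h0
    have := Q.da.g _ hy (by rw [d3', h0]; simp)
    rw [← hw3] at this; simpa using this

/-- rotate clockwise -/
noncomputable def rot (d : E2) : E2 := !₂[d 1, - d 0]

theorem rot_ne (d : E2) (hd : d ≠ 0) : rot d ≠ 0 := by
  intro h
  apply hd
  have h0 := congrArg (fun v : E2 => v 0) h
  have h1 := congrArg (fun v : E2 => v 1) h
  simp [rot] at h0 h1
  ext i; fin_cases i <;> simp [h0, h1]

theorem inner_rot (d y : E2) : ⟪y, rot d⟫ = - D d y := by
  simp [rot, D, PiLp.inner_apply, Fin.sum_univ_two]; ring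

theorem smooth (X : Set E2) (z : E2)
    (hs : ∃! v : E2, ‖v‖ = 1 ∧ ∀ y ∈ X, ⟪y - z, v⟫ ≤ 0)
    (d d' : E2) (hd : d ≠ 0) (hd' : d' ≠ 0) (h : ∀ y ∈ X, 0 ≤ D d (y - z))
    (h' : ∀ y ∈ X, 0 ≤ D d' (y - z)) : ∃ m : ℝ, 0 < m ∧ d' = m • d := by
  have key : ∀ d : E2, d ≠ 0 → (∀ y ∈ X, 0 ≤ D d (y - z)) →
      ‖‖rot d‖⁻¹ • rot d‖ = 1 ∧ ∀ y ∈ X, ⟪y - z, ‖rot d‖⁻¹ • rot d⟫ ≤ 0 := by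
    intro d hd h
    have hn : 0 < ‖rot d‖ := norm_pos_iff.2 (rot_ne d hd)
    refine ⟨by rw [norm_smul, norm_inv, norm_norm]; field_simp, ?_⟩
    intro y hy
    rw [real_inner_smul_right, inner_rot]
    have := mul_nonneg (inv_pos.2 hn).le (h y hy)
    linarith
  have e := hs.unique (key d hd h) (key d' hd' h')
  have hn : 0 < ‖rot d‖ := norm_pos_iff.2 (rot_ne d hd)
  have hn' : 0 < ‖rot d'‖ := norm_pos_iff.2 (rot_ne d' hd')
  generalize ‖rot d‖ = s at *
  generalize ‖rot d'‖ = t at *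
  refine ⟨t * s⁻¹, mul_pos hn' (inv_pos.2 hn), ?_⟩
  have h0 := congrArg (fun v : E2 => v 0) e
  have h1 := congrArg (fun v : E2 => v 1) e
  simp [rot] at h0 h1
  ext i; fin_cases i <;> simp
  · field_simp at h1 ⊢; linarith
  · field_simp at h0 ⊢; linarith

theorem smooth_par (X : Set E2) (z : E2)
    (hs : ∃! v : E2, ‖v‖ = 1 ∧ ∀ y ∈ X, ⟪y - z, v⟫ ≤ 0)
    (d d' : E2) (h : ∀ y ∈ X, 0 ≤ D d (y - z))
    (h' : ∀ y ∈ X, 0 ≤ D d' (y - z)) : D d d' = 0 := by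
  by_cases hd : d = 0
  · simp [hd, D]
  by_cases hd' : d' = 0
  · simp [hd', D]
  obtain ⟨m, -, rfl⟩ := smooth X z hs d d' hd hd' h h'
  simp [D]; ring

theorem lt_case (X : Set E2)
    (hs : ∀ z ∈ frontier X, ∃! v : E2, ‖v‖ = 1 ∧ ∀ y ∈ X, ⟪y - z, v⟫ ≤ 0)
    (z e w1 w3 v1 v3 : E2) (k : ℝ) (hk : 1 < k)
    (T : PosT X z e w1 w3) (T' : PosT X z (k • e) v1 v3)
    (f1 : z + w1 ∈ frontier X) (f3 : z + w3 ∈ frontier X) : False := by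
  have e1 : 0 < D e w1 := lt_of_le_of_ne (T.f0 _ T.m1) (fun h => T.n1 (T.g0 _ T.m1 h.symm))
  have e3 : 0 < D e w3 := lt_of_le_of_ne (T.f0 _ T.m3) (fun h => T.n3 (T.g0 _ T.m3 h.symm))
  refine lin X z e w1 w3 v1 v3 k hk T T' ?_ ?_
  · rintro rfl
    have := smooth_par X (z + v1) (hs _ f1) (v1 - e) (v1 - k • e) ?_ ?_
    · simp [D] at this e1
      nlinarith
    · intro y hy
      have := T.f1 (y - z) (by simpa using hy)
      convert this using 1; simp [D]; ring
    · intro y hy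
      have := T'.f1 (y - z) (by simpa using hy)
      convert this using 1; simp [D]; ring
  · rintro rfl
    have := smooth_par X (z + v3) (hs _ f3) (-e - v3) (-(k • e) - v3) ?_ ?_
    · simp [D] at this e3
      nlinarith
    · intro y hy
      have := T.f3 (y - z) (by simpa using hy)
      convert this using 1; simp [D]; ring
    · intro y hy
      have := T'.f3 (y - z) (by simpa using hy)
      convert this using 1; simp [D]; ring

theorem side_unique (X : Set E2) (hX : IsClosed X) (b c c' : E2) (h : Side X b c)
    (h' : Side X b c') : c = c' := side_cons' X hX c b c' h h'

theorem quad_unique (X : Set E2) (hX : IsClosed X)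
    (hs : ∀ z ∈ frontier X, ∃! v : E2, ‖v‖ = 1 ∧ ∀ y ∈ X, ⟪y - z, v⟫ ≤ 0)
    (a b c d a' b' c' d' : E2) (Q : Quad X a b c d) (Q' : Quad X a' b' c' d')
    (hz : midpoint ℝ a b = midpoint ℝ a' b') : a = a' ∧ b = b' ∧ c = c' ∧ d = d' := by
  obtain ⟨z, hz0⟩ : ∃ z, z = midpoint ℝ a b := ⟨_, rfl⟩
  have hz1 : z = midpoint ℝ a' b' := hz0.trans hz
  have hzf : z ∈ frontier X := hz0 ▸ Q.ab.m
  have T := quad_posT X hX a b c d z (b - z) (midpoint ℝ b c - z) (midpoint ℝ d a - z) Q hz0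
    (by simp) (by simp) (by simp)
  have T' := quad_posT X hX a' b' c' d' z (b' - z) (midpoint ℝ b' c' - z)
    (midpoint ℝ d' a' - z) Q' hz1 (by simp) (by simp) (by simp)
  have hne : ∀ e w1 w3, PosT X z e w1 w3 → e ≠ 0 := by
    rintro e w1 w3 T rfl
    exact T.n1 (T.g0 _ T.m1 (by simp [D]))
  obtain ⟨m, hm, hme⟩ := smooth X z (hs z hzf) (b - z) (b' - z) (hne _ _ _ T) (hne _ _ _ T')
    (fun y hy => T.f0 _ (by simpa using hy)) (fun y hy => T'.f0 _ (by simpa using hy))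
  rcases lt_trichotomy m 1 with h | h | h
  · exfalso
    have hme' : b - z = m⁻¹ • (b' - z) := by
      rw [hme, smul_smul, inv_mul_cancel₀ hm.ne', one_smul]
    rw [hme'] at T
    exact lt_case X hs z _ _ _ _ _ m⁻¹ ((one_lt_inv₀ hm).2 h) T' T
      (by simpa using Q'.bc.m) (by simpa using Q'.da.m)
  · rw [h, one_smul] at hme
    have hb : b' = b := sub_left_inj.1 hme
    subst hb
    have ha : a = a' := by
      rw [midpoint_comm a' b'] at hz
      exact mid_inj _ _ _ hz
    subst ha
    have hc : c = c' := side_unique X hX _ _ _ Q.bc Q'.bc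
    subst hc
    exact ⟨rfl, rfl, rfl, side_unique X hX _ _ _ Q.cd Q'.cd⟩
  · exfalso
    rw [hme] at T'
    exact lt_case X hs z _ _ _ _ _ m h T T' (by simpa using Q.bc.m) (by simpa using Q.da.m)

end OB

/-- Through any tangency point `z ∈ ∂X` of a strongly convex planar body (convex compact
body with smooth boundary, encoded by strict convexity and uniqueness of the outer unit
normal at every boundary point) there passes at most one 4-periodic outer billiard
trajectory. -/
theorem outer_billiard_four_periodic_unique
    (X : Set (EuclideanSpace ℝ (Fin 2)))
    (hXconv : Convex ℝ X) (hXcomp : IsCompact X) (hXint : (interior X).Nonempty)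
    (hXstrict : ∀ p ∈ frontier X, ∀ q ∈ frontier X, p ≠ q →
      openSegment ℝ p q ⊆ interior X)
    (hXsmooth : ∀ z ∈ frontier X, ∃! v : EuclideanSpace ℝ (Fin 2),
      ‖v‖ = 1 ∧ ∀ y ∈ X, ⟪y - z, v⟫ ≤ 0)
    (x x' : Fin 4 → EuclideanSpace ℝ (Fin 2))
    (hx : IsOuterTraj4 X x) (hx' : IsOuterTraj4 X x')
    (hz : midpoint ℝ (x 0) (x 1) = midpoint ℝ (x' 0) (x' 1)) :
    Set.range x = Set.range x' := by
  obtain ⟨a, b, c, d, Q, hm, hr⟩ := OB.norm_traj X hXconv hXcomp.isClosed hXint x hx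
  obtain ⟨a', b', c', d', Q', hm', hr'⟩ := OB.norm_traj X hXconv hXcomp.isClosed hXint x' hx'
  obtain ⟨rfl, rfl, rfl, rfl⟩ := OB.quad_unique X hXcomp.isClosed hXsmooth a b c d a' b' c' d' Q Q'
    (by rw [hm, hm', hz])
  rw [hr, hr']
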